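/- Let Λ be an Artin algebra, d > 1, and X ⊆ mod Λ a generating, cogenerating, functorially finite additive subcategory closed under direct summands with Ext^i_Λ(X, X') = 0 for all X, X' ∈ X and 0 < i < d. Define ⊥_d X = {M : Ext^i(M, X) = 0 for 0 < i < d, all X ∈ X} and X^{⊥_d} = {M : Ext^i(X, M) = 0 for 0 < i < d, all X ∈ X}. If X^{⊥_d} ⊆ ⊥_2 X and ⊥_d X ⊆ X^{⊥_2}, then ⊥_d X = X^{⊥_d}. -/

import Mathlib

open CategoryTheory CategoryTheory.Limits

universe u

variable {A : Type*} [Category A] [Abelian A]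

/-- `g : x ⟶ a` is a right `X`-approximation of `a`. -/
def IsRightApprox (X : Set A) {x a : A} (g : x ⟶ a) : Prop :=
  x ∈ X ∧ ∀ ⦃t : A⦄, t ∈ X → ∀ h : t ⟶ a, ∃ k : t ⟶ x, k ≫ g = h

/-- `g : a ⟶ x` is a left `X`-approximation of `a`. -/
def IsLeftApprox (X : Set A) {a x : A} (g : a ⟶ x) : Prop :=
  x ∈ X ∧ ∀ ⦃t : A⦄, t ∈ X → ∀ h : a ⟶ t, ∃ k : x ⟶ t, g ≫ k = h

open CategoryTheory.Abelian

section ApproximationLemmas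

variable {C : Type*} [Category C]

lemma IsLeftApprox.mono {X : Set C} {a x y : C} {g : a ⟶ x} (hg : IsLeftApprox X g)
    (hy : y ∈ X) (i : a ⟶ y) [Mono i] : Mono g := by
  obtain ⟨k, hk⟩ := hg.2 hy i
  have : Mono (g ≫ k) := by rw [hk]; infer_instance
  exact mono_of_mono g k

lemma IsRightApprox.epi {X : Set C} {a x y : C} {g : x ⟶ a} (hg : IsRightApprox X g)
    (hy : y ∈ X) (p : y ⟶ a) [Epi p] : Epi g := by
  obtain ⟨k, hk⟩ := hg.2 hy p
  have : Epi (k ≫ g) := by rw [hk]; infer_instance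
  exact epi_of_epi k g

variable [Abelian C] [HasExt C] {S : ShortComplex C}

lemma subsingleton_ext_X₁_of_shortExact (hS : S.ShortExact) (Y : C) (n : ℕ)
    (h₃ : Subsingleton (Ext Y S.X₃ n)) (h₂ : Subsingleton (Ext Y S.X₂ (n + 1))) :
    Subsingleton (Ext Y S.X₁ (n + 1)) := by
  refine subsingleton_of_forall_eq 0 fun e => ?_
  obtain ⟨e', rfl⟩ := Ext.covariant_sequence_exact₁ Y hS e (Subsingleton.elim _ _) rfl
  rw [Subsingleton.elim e' 0, Ext.zero_comp]

lemma subsingleton_ext_X₃_of_shortExact (hS : S.ShortExact) (Y : C) (n : ℕ)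
    (h₁ : Subsingleton (Ext S.X₁ Y n)) (h₂ : Subsingleton (Ext S.X₂ Y (n + 1))) :
    Subsingleton (Ext S.X₃ Y (n + 1)) := by
  refine subsingleton_of_forall_eq 0 fun e => ?_
  obtain ⟨e', rfl⟩ := Ext.contravariant_sequence_exact₃ hS Y e (Subsingleton.elim _ _)
    (Nat.add_comm 1 n)
  rw [Subsingleton.elim e' 0, Ext.comp_zero]

/-- The cokernel of a left `X`-approximation has no first extensions by objects of `X`. -/
lemma subsingleton_ext_one_of_isLeftApprox {X : Set C} (hS : S.ShortExact)
    (hf : IsLeftApprox X S.f) {Y : C} (hY : Y ∈ X) (h₂ : Subsingleton (Ext S.X₂ Y 1)) :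
    Subsingleton (Ext S.X₃ Y 1) := by
  refine subsingleton_of_forall_eq 0 fun e => ?_
  obtain ⟨e', rfl⟩ := Ext.contravariant_sequence_exact₃ hS Y e (Subsingleton.elim _ _)
    (Nat.add_zero 1)
  obtain ⟨φ, rfl⟩ := (Ext.mk₀_bijective _ _).2 e'
  obtain ⟨ψ, rfl⟩ := hf.2 hY φ
  rw [← Ext.mk₀_comp_mk₀, hS.extClass_comp_assoc]

/-- The kernel of a right `X`-approximation has no first extensions from objects of `X`. -/
lemma subsingleton_ext_one_of_isRightApprox {X : Set C} (hS : S.ShortExact)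
    (hg : IsRightApprox X S.g) {Y : C} (hY : Y ∈ X) (h₂ : Subsingleton (Ext Y S.X₂ 1)) :
    Subsingleton (Ext Y S.X₁ 1) := by
  refine subsingleton_of_forall_eq 0 fun e => ?_
  obtain ⟨e', rfl⟩ := Ext.covariant_sequence_exact₁ Y hS e (Subsingleton.elim _ _)
    (Nat.zero_add 1)
  obtain ⟨φ, rfl⟩ := (Ext.mk₀_bijective _ _).2 e'
  obtain ⟨ψ, rfl⟩ := hg.2 hY φ
  rw [← Ext.mk₀_comp_mk₀, Ext.comp_assoc_of_second_deg_zero, hS.comp_extClass, Ext.comp_zero]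

/-- If every object of `⊥_d X` satisfying `P` has no first extensions from `X`, and `X` is
`d`-rigid with enough monic left approximations, then such objects lie in `X^{⊥_d}`. -/
lemma subsingleton_ext_of_left_perp {X : Set C} {P : C → Prop} {d : ℕ}
    (happrox : ∀ M, P M → ∃ (x : C) (f : M ⟶ x), IsLeftApprox X f ∧ Mono f ∧ P (cokernel f))
    (hext : ∀ x ∈ X, ∀ x' ∈ X, ∀ i : ℕ, 0 < i → i < d → Subsingleton (Ext x x' i))
    (hone : ∀ M, P M → (∀ x ∈ X, ∀ i : ℕ, 0 < i → i < d → Subsingleton (Ext M x i)) →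
      ∀ x ∈ X, Subsingleton (Ext x M 1))
    {M : C} (hP : P M)
    (hM : ∀ x ∈ X, ∀ i : ℕ, 0 < i → i < d → Subsingleton (Ext M x i))
    {x : C} (hx : x ∈ X) {i : ℕ} (hi : 0 < i) (hid : i < d) :
    Subsingleton (Ext x M i) := by
  induction i, hi using Nat.le_induction generalizing M with
  | base => exact hone M hP hM x hx
  | succ n hn ih =>
    obtain ⟨y, f, hf, _, hPc⟩ := happrox M hP
    have hS : (ShortComplex.mk f (cokernel.π f) (cokernel.condition f)).ShortExact :=
      { exact := ShortComplex.exact_cokernel f }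
    refine subsingleton_ext_X₁_of_shortExact hS x n (ih hPc (fun z hz j hj hjd => ?_) (by lia))
      (hext x hx y hf.1 _ (by lia) hid)
    obtain _ | _ | j := j
    · lia
    · exact subsingleton_ext_one_of_isLeftApprox hS hf hz (hext y hf.1 z hz 1 hj hjd)
    · exact subsingleton_ext_X₃_of_shortExact hS z (j + 1) (hM z hz _ (by lia) (by lia))
        (hext y hf.1 z hz _ hj hjd)

/-- If every object of `X^{⊥_d}` satisfying `P` has no first extensions by `X`, and `X` is
`d`-rigid with enough epic right approximations, then such objects lie in `⊥_d X`. -/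
lemma subsingleton_ext_of_right_perp {X : Set C} {P : C → Prop} {d : ℕ}
    (happrox : ∀ M, P M → ∃ (x : C) (g : x ⟶ M), IsRightApprox X g ∧ Epi g ∧ P (kernel g))
    (hext : ∀ x ∈ X, ∀ x' ∈ X, ∀ i : ℕ, 0 < i → i < d → Subsingleton (Ext x x' i))
    (hone : ∀ M, P M → (∀ x ∈ X, ∀ i : ℕ, 0 < i → i < d → Subsingleton (Ext x M i)) →
      ∀ x ∈ X, Subsingleton (Ext M x 1))
    {M : C} (hP : P M)
    (hM : ∀ x ∈ X, ∀ i : ℕ, 0 < i → i < d → Subsingleton (Ext x M i))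
    {x : C} (hx : x ∈ X) {i : ℕ} (hi : 0 < i) (hid : i < d) :
    Subsingleton (Ext M x i) := by
  induction i, hi using Nat.le_induction generalizing M with
  | base => exact hone M hP hM x hx
  | succ n hn ih =>
    obtain ⟨y, g, hg, _, hPk⟩ := happrox M hP
    have hS : (ShortComplex.mk (kernel.ι g) g (kernel.condition g)).ShortExact :=
      { exact := ShortComplex.exact_kernel g }
    refine subsingleton_ext_X₃_of_shortExact hS x n (ih hPk (fun z hz j hj hjd => ?_) (by lia))
      (hext y hg.1 x hx _ (by lia) hid)
    obtain _ | _ | j := j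
    · lia
    · exact subsingleton_ext_one_of_isRightApprox hS hg hz (hext z hz y hg.1 1 hj hjd)
    · exact subsingleton_ext_X₁_of_shortExact hS z (j + 1) (hM z hz _ (by lia) (by lia))
        (hext z hz y hg.1 _ hj hjd)

end ApproximationLemmas

/-- Let `Λ` be an Artin algebra and `X ⊆ mod Λ` a generating cogenerating functorially
finite subcategory closed under direct summands with `Ext^i(X, X') = 0` for `0 < i < d`.
If `X^{⊥_d} ⊆ ⊥₂X` and `⊥_d X ⊆ X^{⊥₂}`, then `⊥_d X = X^{⊥_d}`. -/
theorem perp_eq_of_perp_inclusions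
    (R : Type u) [CommRing R] [IsArtinianRing R]
    (Λ : Type u) [Ring Λ] [Algebra R Λ] [Module.Finite R Λ]
    [CategoryTheory.HasExt.{u} (ModuleCat.{u} Λ)]
    (d : ℕ) (hd : 1 < d)
    (X : Set (ModuleCat.{u} Λ))
    (hfg : ∀ M ∈ X, Module.Finite Λ M)
    (hsum : ∀ ⦃M x : ModuleCat.{u} Λ⦄, x ∈ X →
      ∀ (i : M ⟶ x) (r : x ⟶ M), i ≫ r = 𝟙 M → M ∈ X)
    (hgen : ∀ M : ModuleCat.{u} Λ, Module.Finite Λ M → ∃ x ∈ X, ∃ p : x ⟶ M, Epi p)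
    (hcog : ∀ M : ModuleCat.{u} Λ, Module.Finite Λ M → ∃ x ∈ X, ∃ i : M ⟶ x, Mono i)
    (hcf : ∀ M : ModuleCat.{u} Λ, Module.Finite Λ M →
      ∃ (x : ModuleCat.{u} Λ) (g : x ⟶ M), IsRightApprox X g)
    (hco : ∀ M : ModuleCat.{u} Λ, Module.Finite Λ M →
      ∃ (x : ModuleCat.{u} Λ) (g : M ⟶ x), IsLeftApprox X g)
    (hext : ∀ x ∈ X, ∀ x' ∈ X, ∀ i : ℕ, 0 < i → i < d →
      Subsingleton (CategoryTheory.Abelian.Ext x x' i))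
    (h₁ : {M : ModuleCat.{u} Λ | Module.Finite Λ M ∧ ∀ x ∈ X, ∀ i : ℕ, 0 < i → i < d →
            Subsingleton (CategoryTheory.Abelian.Ext x M i)} ⊆
          {M : ModuleCat.{u} Λ | Module.Finite Λ M ∧ ∀ x ∈ X, ∀ i : ℕ, 0 < i → i < 2 →
            Subsingleton (CategoryTheory.Abelian.Ext M x i)})
    (h₂ : {M : ModuleCat.{u} Λ | Module.Finite Λ M ∧ ∀ x ∈ X, ∀ i : ℕ, 0 < i → i < d →
            Subsingleton (CategoryTheory.Abelian.Ext M x i)} ⊆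
          {M : ModuleCat.{u} Λ | Module.Finite Λ M ∧ ∀ x ∈ X, ∀ i : ℕ, 0 < i → i < 2 →
            Subsingleton (CategoryTheory.Abelian.Ext x M i)}) :
    {M : ModuleCat.{u} Λ | Module.Finite Λ M ∧ ∀ x ∈ X, ∀ i : ℕ, 0 < i → i < d →
      Subsingleton (CategoryTheory.Abelian.Ext M x i)} =
    {M : ModuleCat.{u} Λ | Module.Finite Λ M ∧ ∀ x ∈ X, ∀ i : ℕ, 0 < i → i < d →
      Subsingleton (CategoryTheory.Abelian.Ext x M i)} := by
  have : IsNoetherian R Λ := isNoetherian_of_isNoetherianRing_of_finite R Λ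
  have : IsNoetherianRing Λ := isNoetherian_of_tower R this
  have hleft : ∀ M : ModuleCat.{u} Λ, Module.Finite Λ M → ∃ (x : ModuleCat.{u} Λ) (f : M ⟶ x),
      IsLeftApprox X f ∧ Mono f ∧ Module.Finite Λ (cokernel f : ModuleCat.{u} Λ) := by
    intro M hM
    obtain ⟨x, f, hf⟩ := hco M hM
    obtain ⟨y, hy, i, _⟩ := hcog M hM
    have := hfg x hf.1
    exact ⟨x, f, hf, hf.mono hy i, Module.Finite.of_surjective (cokernel.π f).hom
      ((ModuleCat.epi_iff_surjective _).1 inferInstance)⟩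
  have hright : ∀ M : ModuleCat.{u} Λ, Module.Finite Λ M → ∃ (x : ModuleCat.{u} Λ) (g : x ⟶ M),
      IsRightApprox X g ∧ Epi g ∧ Module.Finite Λ (kernel g : ModuleCat.{u} Λ) := by
    intro M hM
    obtain ⟨x, g, hg⟩ := hcf M hM
    obtain ⟨y, hy, p, _⟩ := hgen M hM
    have := hfg x hg.1
    exact ⟨x, g, hg, hg.epi hy p, Module.Finite.of_injective (kernel.ι g).hom
      ((ModuleCat.mono_iff_injective _).1 inferInstance)⟩
  refine Set.Subset.antisymm ?_ ?_
  · rintro M ⟨hM, hMX⟩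
    exact ⟨hM, fun x hx i hi hid => subsingleton_ext_of_left_perp hleft hext
      (fun N hN hNX y hy => (h₂ ⟨hN, hNX⟩).2 y hy 1 one_pos one_lt_two) hM hMX hx hi hid⟩
  · rintro M ⟨hM, hMX⟩
    exact ⟨hM, fun x hx i hi hid => subsingleton_ext_of_right_perp hright hext
      (fun N hN hNX y hy => (h₁ ⟨hN, hNX⟩).2 y hy 1 one_pos one_lt_two) hM hMX hx hi hid⟩
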